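/- Let G be a group and R a G-graded ring (R = ⊕_{g∈G} R_g with R_g·R_h ⊆ R_{gh} and 1 ∈ R_e) whose identity component R_e is commutative, equipped with an action of G on R by ring automorphisms satisfying g·R_h ⊆ R_{ghg⁻¹}, and satisfying G-crossed commutativity: x·y = (g·y)·x for every homogeneous x ∈ R_g and every y ∈ R. Let ω : G × G → R_e^× (units of R_e) satisfy the cocycle condition (g·ω(h,k))·ω(g,hk) = ω(g,h)·ω(gh,k) for all g,h,k ∈ G. Then the twisted product, defined on homogeneous elements x ∈ R_g, y ∈ R_h by x ⊗_ω y := ω(g,h)·x·y and extended ℤ-bilinearly, is associative. -/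

import Mathlib

/-- To prove a property of all elements of an internal direct sum of additive subgroups, it
suffices to prove it for homogeneous elements and show that it is stable under addition. -/
theorem DirectSum.IsInternal.addSubgroup_induction {ι M : Type*} [DecidableEq ι]
    [AddCommGroup M] {A : ι → AddSubgroup M} (hA : DirectSum.IsInternal fun i => A i)
    {motive : M → Prop} (zero : motive 0) (mem : ∀ i, ∀ x ∈ A i, motive x)
    (add : ∀ x y, motive x → motive y → motive (x + y)) (x : M) : motive x := by
  obtain ⟨x, rfl⟩ := hA.2 x
  induction x using DirectSum.induction_on with
  | zero => simpa using zero
  | of i x => simpa using mem i x x.2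
  | add x y hx hy => simpa using add _ _ hx hy

/-- Let `G` be a group and `R` a `G`-graded ring (`R = ⊕_g R_g`,
`R_g·R_h ⊆ R_{gh}`, `1 ∈ R_e`) whose identity component is commutative, with a `G`-action
by ring automorphisms satisfying `g·R_h ⊆ R_{ghg⁻¹}` and `G`-crossed commutativity
`x·y = (g·y)·x` for homogeneous `x ∈ R_g`.  If `ω : G × G → R_e^×` satisfies the cocycle
condition `(g·ω(h,k))·ω(g,hk) = ω(g,h)·ω(gh,k)`, then the twisted product, defined on
homogeneous `x ∈ R_g`, `y ∈ R_h` by `x ⊗_ω y := ω(g,h)·x·y` and extended `ℤ`-bilinearly,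
is associative. -/
theorem twisted_product_assoc {G R : Type} [Group G] [DecidableEq G] [Ring R]
    (Gr : G → AddSubgroup R)
    (hdirect : DirectSum.IsInternal fun g : G => Gr g)
    (hone : (1 : R) ∈ Gr 1)
    (hgrmul : ∀ (g h : G) (x y : R), x ∈ Gr g → y ∈ Gr h → x * y ∈ Gr (g * h))
    (hcommE : ∀ x y : R, x ∈ Gr 1 → y ∈ Gr 1 → x * y = y * x)
    (act : G →* RingAut R)
    (hactGr : ∀ (g h : G) (x : R), x ∈ Gr h → act g x ∈ Gr (g * h * g⁻¹))
    (hcross : ∀ (g : G) (x : R), x ∈ Gr g → ∀ y : R, x * y = act g y * x)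
    (ω : G → G → Rˣ)
    (hωmem : ∀ g h : G, ((ω g h : Rˣ) : R) ∈ Gr 1 ∧ (((ω g h)⁻¹ : Rˣ) : R) ∈ Gr 1)
    (hcocycle : ∀ g h k : G,
      act g ((ω h k : Rˣ) : R) * ((ω g (h * k) : Rˣ) : R)
        = ((ω g h : Rˣ) : R) * ((ω (g * h) k : Rˣ) : R))
    (tmul : R → R → R)
    (htmul_addl : ∀ x y z : R, tmul (x + y) z = tmul x z + tmul y z)
    (htmul_addr : ∀ x y z : R, tmul x (y + z) = tmul x y + tmul x z)
    (htmul_hom : ∀ (g h : G) (x y : R), x ∈ Gr g → y ∈ Gr h →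
      tmul x y = ((ω g h : Rˣ) : R) * x * y) :
    ∀ x y z : R, tmul (tmul x y) z = tmul x (tmul y z) := by
  have zero_tmul : ∀ z, tmul 0 z = 0 := fun z => by simpa using htmul_addl 0 0 z
  have tmul_zero : ∀ x, tmul x 0 = 0 := fun x => by simpa using htmul_addr x 0 0
  have assoc_hom : ∀ (g h k : G) (x y z : R), x ∈ Gr g → y ∈ Gr h → z ∈ Gr k →
      tmul (tmul x y) z = tmul x (tmul y z) := by
    intro g h k x y z hx hy hz
    have hxy : (ω g h : R) * x * y ∈ Gr (g * h) := by
      simpa [mul_assoc] using hgrmul 1 (g * h) _ _ (hωmem g h).1 (hgrmul g h x y hx hy)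
    have hyz : (ω h k : R) * y * z ∈ Gr (h * k) := by
      simpa [mul_assoc] using hgrmul 1 (h * k) _ _ (hωmem h k).1 (hgrmul h k y z hy hz)
    have hact : act g (ω h k : R) ∈ Gr 1 := by simpa using hactGr g 1 _ (hωmem h k).1
    rw [htmul_hom g h x y hx hy, htmul_hom h k y z hy hz,
      htmul_hom (g * h) k _ z hxy hz, htmul_hom g (h * k) x _ hx hyz]
    calc (ω (g * h) k : R) * ((ω g h : R) * x * y) * z
        = (ω (g * h) k : R) * (ω g h : R) * (x * y * z) := by simp only [mul_assoc]
      _ = (ω g (h * k) : R) * act g (ω h k : R) * (x * y * z) := by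
        rw [hcommE _ _ (hωmem (g * h) k).1 (hωmem g h).1, ← hcocycle,
          hcommE _ _ hact (hωmem g (h * k)).1]
      _ = (ω g (h * k) : R) * (act g (ω h k : R) * x) * (y * z) := by simp only [mul_assoc]
      _ = (ω g (h * k) : R) * x * ((ω h k : R) * y * z) := by
        rw [← hcross g x hx]; simp only [mul_assoc]
  intro x y z
  induction x using hdirect.addSubgroup_induction with
  | zero => simp only [zero_tmul]
  | add x₁ x₂ h₁ h₂ => simp only [htmul_addl, h₁, h₂]
  | mem g x hx =>
    induction y using hdirect.addSubgroup_induction with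
    | zero => simp only [zero_tmul, tmul_zero]
    | add y₁ y₂ h₁ h₂ => simp only [htmul_addl, htmul_addr, h₁, h₂]
    | mem h y hy =>
      induction z using hdirect.addSubgroup_induction with
      | zero => simp only [tmul_zero]
      | add z₁ z₂ h₁ h₂ => simp only [htmul_addr, h₁, h₂]
      | mem k z hz => exact assoc_hom g h k x y z hx hy hz
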